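/- For every positive integer m and every θ ∈ (0,1): if θ > φ_m² then L_{m+1}(θ) < L_m(θ), and if θ < φ_m² then L_m(θ) < L_{m+1}(θ); that is, L_{m+1} intersects L_m from above at the point φ_m². -/

import Mathlib

open Classical in
/-- Asymptotic average code-length `L_m(θ)` of the modified Rice–Golomb code. -/
noncomputable def asympLen (m : ℕ) (θ : ℝ) : ℝ :=
  if ∃ β : ℕ, m = 2 ^ β then
    1 + Real.logb 2 m + θ ^ ((m : ℝ)/2) / (1 - θ ^ ((m : ℝ)/2))
  else
    1 + (Nat.log 2 m : ℝ) +
      θ ^ (((2 ^ Nat.clog 2 m - m : ℕ) : ℝ)/2) / (1 - θ ^ ((m : ℝ)/2))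

/-- On a dyadic block, both endpoints included, the code-length in the variable `x = √θ`
is given by a single formula. -/
theorem asympLen_sq_of_mem_dyadic {m k : ℕ} (h₁ : 2 ^ k ≤ m) (h₂ : m ≤ 2 ^ (k + 1)) {x : ℝ}
    (hx : x ∈ Set.Ioo (0 : ℝ) 1) :
    asympLen m (x ^ 2) = 1 + k + x ^ (2 ^ (k + 1) - m) / (1 - x ^ m) := by
  have hpow (n : ℕ) : (x ^ 2) ^ ((n : ℝ) / 2) = x ^ n := by
    rw [← Real.rpow_natCast x 2, ← Real.rpow_mul hx.1.le, ← Real.rpow_natCast x n]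
    congr 1
    push_cast
    ring
  have hm : m ≠ 0 := (lt_of_lt_of_le (by positivity) h₁).ne'
  unfold asympLen
  rw [hpow, hpow]
  split_ifs with h
  · obtain ⟨β, rfl⟩ := h
    have hlog : Real.logb 2 ((2 ^ β : ℕ) : ℝ) = β := by
      push_cast
      rw [Real.logb_pow, Real.logb_self_eq_one (by norm_num), mul_one]
    have hβ₁ : k ≤ β := (Nat.pow_le_pow_iff_right (by norm_num)).1 h₁
    have hβ₂ : β ≤ k + 1 := (Nat.pow_le_pow_iff_right (by norm_num)).1 h₂
    rw [hlog]
    obtain rfl | rfl : β = k ∨ β = k + 1 := by omega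
    · rw [show 2 ^ (β + 1) - 2 ^ β = 2 ^ β by rw [pow_succ]; omega]
    · have hne : 1 - x ^ 2 ^ (k + 1) ≠ 0 :=
        (sub_pos.2 (pow_lt_one₀ hx.1.le hx.2 hm)).ne'
      rw [Nat.sub_self, pow_zero]
      field_simp
      push_cast
      ring
  · have hlt₁ : 2 ^ k < m := lt_of_le_of_ne h₁ fun e => h ⟨k, e.symm⟩
    have hlt₂ : m < 2 ^ (k + 1) := lt_of_le_of_ne h₂ fun e => h ⟨k + 1, e⟩
    have hlog : Nat.log 2 m = k := Nat.log_eq_of_pow_le_of_lt_pow h₁ hlt₂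
    have hclog : Nat.clog 2 m = k + 1 :=
      le_antisymm (Nat.clog_le_of_le_pow h₂) ((Nat.lt_clog_iff_pow_lt (by norm_num)).2 hlt₁)
    rw [hlog, hclog]

/-- The difference of consecutive code-lengths is a positive multiple of
`x ^ (m + 1) + x ^ m - 1`, where `x = √θ`. -/
theorem exists_pos_asympLen_sub_succ {m : ℕ} (hm : 0 < m) {x : ℝ}
    (hx : x ∈ Set.Ioo (0 : ℝ) 1) :
    ∃ c : ℝ, 0 < c ∧
      asympLen m (x ^ 2) - asympLen (m + 1) (x ^ 2) = c * (x ^ (m + 1) + x ^ m - 1) := by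
  have h₁ : 2 ^ Nat.log 2 m ≤ m := Nat.pow_log_le_self 2 hm.ne'
  have h₂ : m < 2 ^ (Nat.log 2 m + 1) := Nat.lt_pow_succ_log_self (by norm_num) m
  have hd₁ : 0 < 1 - x ^ m := sub_pos.2 (pow_lt_one₀ hx.1.le hx.2 hm.ne')
  have hd₂ : 0 < 1 - x ^ (m + 1) := sub_pos.2 (pow_lt_one₀ hx.1.le hx.2 (Nat.add_one_ne_zero m))
  have hx₀ := hx.1
  have hx₁ : 0 < 1 - x := sub_pos.2 hx.2
  refine ⟨x ^ (2 ^ (Nat.log 2 m + 1) - (m + 1)) * (1 - x) / ((1 - x ^ m) * (1 - x ^ (m + 1))),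
    by positivity, ?_⟩
  rw [asympLen_sq_of_mem_dyadic h₁ h₂.le hx,
    asympLen_sq_of_mem_dyadic (m := m + 1) (by omega) h₂ hx,
    show 2 ^ (Nat.log 2 m + 1) - m = 2 ^ (Nat.log 2 m + 1) - (m + 1) + 1 by omega]
  generalize 2 ^ (Nat.log 2 m + 1) - (m + 1) = e
  have hn₁ := hd₁.ne'
  have hn₂ := hd₂.ne'
  field_simp
  ring

/-- `L_{m+1}` intersects `L_m` from above at `φ_m²`:
for `θ > φ_m²`, `L_{m+1}(θ) < L_m(θ)`, and for `θ < φ_m²`, `L_m(θ) < L_{m+1}(θ)`. -/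
theorem intersect_from_above (m : ℕ) (hm : 0 < m) (φ : ℝ)
    (hφ : φ ∈ Set.Ioo (0:ℝ) 1 ∧ φ ^ (m + 1) + φ ^ m - 1 = 0) :
    ∀ θ ∈ Set.Ioo (0:ℝ) 1,
      (φ ^ 2 < θ → asympLen (m + 1) θ < asympLen m θ) ∧
      (θ < φ ^ 2 → asympLen m θ < asympLen (m + 1) θ) := by
  intro θ hθ
  obtain ⟨⟨hφ₀, -⟩, hroot⟩ := hφ
  obtain ⟨x, hx, rfl⟩ : ∃ x ∈ Set.Ioo (0 : ℝ) 1, x ^ 2 = θ :=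
    ⟨√θ, ⟨Real.sqrt_pos.2 hθ.1, (Real.sqrt_lt' one_pos).2 (by simpa using hθ.2)⟩,
      Real.sq_sqrt hθ.1.le⟩
  obtain ⟨c, hc, hdiff⟩ := exists_pos_asympLen_sub_succ hm hx
  constructor
  · intro h
    have hlt : φ < x := lt_of_pow_lt_pow_left₀ 2 hx.1.le h
    have hpow₁ := pow_lt_pow_left₀ hlt hφ₀.le hm.ne'
    have hpow₂ := pow_lt_pow_left₀ hlt hφ₀.le (Nat.add_one_ne_zero m)
    have hpos := mul_pos hc (show 0 < x ^ (m + 1) + x ^ m - 1 by linarith)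
    linarith
  · intro h
    have hlt : x < φ := lt_of_pow_lt_pow_left₀ 2 hφ₀.le h
    have hpow₁ := pow_lt_pow_left₀ hlt hx.1.le hm.ne'
    have hpow₂ := pow_lt_pow_left₀ hlt hx.1.le (Nat.add_one_ne_zero m)
    have hneg := mul_neg_of_pos_of_neg hc (show x ^ (m + 1) + x ^ m - 1 < 0 by linarith)
    linarith
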